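/- arXiv:1512.07128 — 2 statements merged into one kernel-verified Lean document; each statement's English description precedes it below -/
import Mathlib

section
/- For every u ∈ ℂ, the element W := a'(u)·(xyz + zxy + yzx) + b'(u)·(zyx + xzy + yxz) + c'(u)·(x³ + y³ + z³) is central in the Sklyanin algebra Sky₃(a(u), b(u), c(u)), i.e. W·r = r·W for every element r of the algebra. -/
open Complex

/-- The theta function `Θ_j(u) = ∑_{m ∈ ℤ, m ≡ j (mod 3)} exp(πiτm²/3 + 2πimu)`,
parametrized as `m = 3k + j`.  We set `a(u) = Θ₀(u)`, `c(u) = Θ₁(u)`, `b(u) = Θ₂(u)`. -/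
noncomputable def Theta (τ u : ℂ) (j : ℤ) : ℂ :=
  ∑' k : ℤ, Complex.exp (Real.pi * I * τ * (3 * (k : ℂ) + (j : ℂ)) ^ 2 / 3
      + 2 * Real.pi * I * (3 * (k : ℂ) + (j : ℂ)) * u)

/-- The termwise derivative `Θ'_j(u) = ∑_{m ≡ j (mod 3)} 2πim·exp(πiτm²/3 + 2πimu)`,
so `a'(u) = Θ'₀(u)`, `c'(u) = Θ'₁(u)`, `b'(u) = Θ'₂(u)`. -/
noncomputable def ThetaDeriv (τ u : ℂ) (j : ℤ) : ℂ :=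
  ∑' k : ℤ, (2 * Real.pi * I * (3 * (k : ℂ) + (j : ℂ))) *
    Complex.exp (Real.pi * I * τ * (3 * (k : ℂ) + (j : ℂ)) ^ 2 / 3
      + 2 * Real.pi * I * (3 * (k : ℂ) + (j : ℂ)) * u)

/-- Generators `x = G 0`, `y = G 1`, `z = G 2` of the free algebra `ℂ⟨x,y,z⟩`. -/
noncomputable def G (i : Fin 3) : FreeAlgebra ℂ (Fin 3) := FreeAlgebra.ι ℂ i

/-- The defining relations of the Sklyanin algebra `Sky₃(a,b,c)`:
`a·xy + b·yx + c·z² = 0`, `a·yz + b·zy + c·x² = 0`, `a·zx + b·xz + c·y² = 0`. -/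
inductive SklyRel (a b c : ℂ) :
    FreeAlgebra ℂ (Fin 3) → FreeAlgebra ℂ (Fin 3) → Prop
  | rel_xy : SklyRel a b c (a • (G 0 * G 1) + b • (G 1 * G 0) + c • (G 2 * G 2)) 0
  | rel_yz : SklyRel a b c (a • (G 1 * G 2) + b • (G 2 * G 1) + c • (G 0 * G 0)) 0
  | rel_zx : SklyRel a b c (a • (G 2 * G 0) + b • (G 0 * G 2) + c • (G 1 * G 1)) 0

/-- The Sklyanin algebra `Sky₃(a,b,c)`, the quotient of the free noncommutative
unital `ℂ`-algebra `ℂ⟨x,y,z⟩` by the two-sided ideal generated by the three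
Sklyanin relations. -/
abbrev Sky (a b c : ℂ) := RingQuot (SklyRel a b c)

/-- The generator `x` of `Sky₃(a,b,c)`. -/
noncomputable def skX (a b c : ℂ) : Sky a b c :=
  RingQuot.mkAlgHom ℂ (SklyRel a b c) (G 0)

/-- The generator `y` of `Sky₃(a,b,c)`. -/
noncomputable def skY (a b c : ℂ) : Sky a b c :=
  RingQuot.mkAlgHom ℂ (SklyRel a b c) (G 1)

/-- The generator `z` of `Sky₃(a,b,c)`. -/
noncomputable def skZ (a b c : ℂ) : Sky a b c :=
  RingQuot.mkAlgHom ℂ (SklyRel a b c) (G 2)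

/-- The worldsheet superpotential
`W = a'(u)·(xyz + zxy + yzx) + b'(u)·(zyx + xzy + yxz) + c'(u)·(x³ + y³ + z³)`
as an element of the Sklyanin algebra `Sky₃(a(u), b(u), c(u))`. -/
noncomputable def sklyW (τ u : ℂ) : Sky (Theta τ u 0) (Theta τ u 2) (Theta τ u 1) :=
  let x := skX (Theta τ u 0) (Theta τ u 2) (Theta τ u 1)
  let y := skY (Theta τ u 0) (Theta τ u 2) (Theta τ u 1)
  let z := skZ (Theta τ u 0) (Theta τ u 2) (Theta τ u 1)
  ThetaDeriv τ u 0 • (x * y * z + z * x * y + y * z * x)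
    + ThetaDeriv τ u 2 • (z * y * x + x * z * y + y * x * z)
    + ThetaDeriv τ u 1 • (x ^ 3 + y ^ 3 + z ^ 3)

/-- The cyclically symmetric cubic
`α (xyz + zxy + yzx) + β (zyx + xzy + yxz) + γ (x³ + y³ + z³)`. -/
def cyclicCubic {R : Type*} [Ring R] [Algebra ℂ R] (x y z : R) (α β γ : ℂ) : R :=
  α • (x * y * z + z * x * y + y * z * x) + β • (z * y * x + x * z * y + y * x * z)
    + γ • (x ^ 3 + y ^ 3 + z ^ 3)

section SklyaninRelations

variable {R : Type*} [Ring R] [Algebra ℂ R] {x y z : R} {a b c lam : ℂ}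

lemma cyclicCubic_rotate (x y z : R) (α β γ : ℂ) :
    cyclicCubic y z x α β γ = cyclicCubic x y z α β γ := by
  unfold cyclicCubic
  abel_nf

lemma cyclicCubic_swap (x y z : R) (α β γ : ℂ) :
    cyclicCubic y x z β α γ = cyclicCubic x y z α β γ := by
  unfold cyclicCubic
  abel_nf

/-- The superpotential of the relations vanishes. -/
lemma cyclicCubic_self (hxy : a • (x * y) + b • (y * x) + c • (z * z) = 0)
    (hyz : a • (y * z) + b • (z * y) + c • (x * x) = 0)
    (hzx : a • (z * x) + b • (x * z) + c • (y * y) = 0) :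
    cyclicCubic x y z a b c = 0 := by
  have key : cyclicCubic x y z a b c = x * (a • (y * z) + b • (z * y) + c • (x * x))
      + y * (a • (z * x) + b • (x * z) + c • (y * y))
      + z * (a • (x * y) + b • (y * x) + c • (z * z)) := by
    simp only [cyclicCubic, mul_add, mul_smul_comm, pow_succ, pow_zero, one_mul, mul_assoc]
    module
  rw [key, hxy, hyz, hzx]
  simp

/-- On the Hesse cubic `a³ + b³ + c³ = λ abc` with `a ≠ 0`, the tangent direction with vanishing
first coordinate gives a cubic commuting with `x`. -/
lemma commute_cyclicCubic_tangent (ha : a ≠ 0) (hS : a ^ 3 + b ^ 3 + c ^ 3 = lam * (a * b * c))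
    (hxy : a • (x * y) + b • (y * x) + c • (z * z) = 0)
    (hyz : a • (y * z) + b • (z * y) + c • (x * x) = 0)
    (hzx : a • (z * x) + b • (x * z) + c • (y * y) = 0) :
    Commute (cyclicCubic x y z 0 (3 * c ^ 2 - lam * (a * b)) (-(3 * b ^ 2 - lam * (a * c)))) x := by
  set W := cyclicCubic x y z 0 (3 * c ^ 2 - lam * (a * b)) (-(3 * b ^ 2 - lam * (a * c))) with hW
  have key : ∀ p q r : R, p = a • (x * y) + b • (y * x) + c • (z * z) →
      q = a • (y * z) + b • (z * y) + c • (x * x) →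
      r = a • (z * x) + b • (x * z) + c • (y * y) →
      a • (W * x - x * W) =
        (a * a * lam) • (2 • (p * z * x) + r * y * x - z * p * x - 2 • (x * q * x)
          - 2 • (x * p * z) - x * r * y + x * z * p + 2 • (x * x * q))
        + (3 * (a * b) * lam) • (p * x * z - y * x * r)
        + (3 * b ^ 2) • (p * y * y - z * z * r)
        + (3 * c ^ 2) • (y * x * r - p * x * z)
        + (3 * (a * c)) • (z * y * q - q * z * y)
        + (3 * (a * a)) • (y * p * y - z * r * z)
        + (3 * (a * b)) • (r * z * z - y * y * p)
        + (3 * (a ^ 3 + b ^ 3 + c ^ 3 - lam * (a * b * c))) • (z * z * x * z - y * x * y * y) := by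
    rintro _ _ _ rfl rfl rfl
    simp only [hW, cyclicCubic, mul_add, add_mul, mul_sub, mul_smul_comm, smul_mul_assoc,
      pow_succ, pow_zero, one_mul, mul_assoc]
    module
  have h := key 0 0 0 hxy.symm hyz.symm hzx.symm
  rw [hS, sub_self] at h
  simp only [zero_mul, mul_zero, smul_zero, sub_zero, add_zero, zero_smul] at h
  exact sub_eq_zero.1 ((smul_eq_zero_iff_right ha).1 h)

/-- At a smooth point of the Hesse cubic with `a ≠ 0`, every tangent vector gives a cubic
commuting with `x`. -/
lemma commute_cyclicCubic_of_ne_zero {α β γ : ℂ} (ha : a ≠ 0) (hlam : lam ^ 3 ≠ 27)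
    (hS : a ^ 3 + b ^ 3 + c ^ 3 = lam * (a * b * c))
    (hT : 3 * (a ^ 2 * α + b ^ 2 * β + c ^ 2 * γ) =
      lam * (b * c * α + a * c * β + a * b * γ))
    (hxy : a • (x * y) + b • (y * x) + c • (z * z) = 0)
    (hyz : a • (y * z) + b • (z * y) + c • (x * x) = 0)
    (hzx : a • (z * x) + b • (x * z) + c • (y * y) = 0) :
    Commute (cyclicCubic x y z α β γ) x := by
  set B := 3 * b ^ 2 - lam * (a * c) with hB
  set C := 3 * c ^ 2 - lam * (a * b) with hC
  have hBC : B * (a * β - α * b) + C * (a * γ - α * c) = 0 := by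
    rw [hB, hC]
    linear_combination a * hT - 3 * α * hS
  have hk : ∃ k, a * β - α * b = k * C ∧ a * γ - α * c = k * -B := by
    by_cases hC0 : C = 0
    · by_cases hB0 : B = 0
      · exfalso
        have h1 : 3 * b ^ 2 = lam * (a * c) := sub_eq_zero.1 hB0
        have h2 : 3 * c ^ 2 = lam * (a * b) := sub_eq_zero.1 hC0
        have h3 : 3 * a ^ 2 = lam * (b * c) := mul_left_cancel₀ ha (by
          linear_combination 3 * hS - b * h1 - c * h2)
        have hbc : b * c ≠ 0 := by
          intro h
          rw [h, mul_zero] at h3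
          simp_all
        refine hlam (mul_right_cancel₀ (pow_ne_zero 2 (mul_ne_zero ha hbc)) ?_)
        linear_combination (-lam ^ 2 * (a * b) * (a * c)) * h3 - 3 * a ^ 2 * lam * (a * b) * h1
          - 9 * a ^ 2 * b ^ 2 * h2
      · refine ⟨-(a * γ - α * c) / B, ?_, by field_simp⟩
        rw [hC0, mul_zero]
        rw [hC0, zero_mul, add_zero] at hBC
        exact (mul_eq_zero.1 hBC).resolve_left hB0
    · refine ⟨(a * β - α * b) / C, by field_simp, ?_⟩
      field_simp
      linear_combination hBC
  obtain ⟨k, hk1, hk2⟩ := hk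
  have hW : a • cyclicCubic x y z α β γ =
      α • cyclicCubic x y z a b c + k • cyclicCubic x y z 0 C (-B) := by
    have e1 : a * β = α * b + k * C := by linear_combination hk1
    have e2 : a * γ = α * c + k * -B := by linear_combination hk2
    simp only [cyclicCubic, smul_add, smul_smul, e1, e2]
    module
  rw [cyclicCubic_self hxy hyz hzx, smul_zero, zero_add] at hW
  have h := (commute_cyclicCubic_tangent ha hS hxy hyz hzx).smul_left k
  rw [← hW] at h
  simpa [smul_smul, inv_mul_cancel₀ ha] using h.smul_left a⁻¹

/-- At a smooth point of the Hesse cubic, every tangent vector gives a cubic commuting with `x`. -/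
lemma commute_cyclicCubic {α β γ : ℂ} (h0 : ¬(a = 0 ∧ b = 0 ∧ c = 0)) (hlam : lam ^ 3 ≠ 27)
    (hS : a ^ 3 + b ^ 3 + c ^ 3 = lam * (a * b * c))
    (hT : 3 * (a ^ 2 * α + b ^ 2 * β + c ^ 2 * γ) =
      lam * (b * c * α + a * c * β + a * b * γ))
    (hxy : a • (x * y) + b • (y * x) + c • (z * z) = 0)
    (hyz : a • (y * z) + b • (z * y) + c • (x * x) = 0)
    (hzx : a • (z * x) + b • (x * z) + c • (y * y) = 0) :
    Commute (cyclicCubic x y z α β γ) x := by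
  by_cases ha : a = 0
  · have hb : b ≠ 0 := by
      rintro rfl
      subst ha
      simp_all
    have h := commute_cyclicCubic_of_ne_zero (x := x) (y := z) (z := y) (α := β) (β := α) (γ := γ)
      hb hlam (c := c) (b := a) (by linear_combination hS) (by linear_combination hT)
      (by rw [← hzx]; abel) (by rw [← hyz]; abel) (by rw [← hxy]; abel)
    rwa [← cyclicCubic_rotate, cyclicCubic_swap, ← cyclicCubic_rotate, ← cyclicCubic_rotate] at h
  · exact commute_cyclicCubic_of_ne_zero ha hlam hS hT hxy hyz hzx

end SklyaninRelations

section ThetaFunctions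

lemma exists_jacobiTheta₂_ne_zero {τ : ℂ} (hτ : 0 < τ.im) : ∃ z, jacobiTheta₂ z τ ≠ 0 := by
  by_contra! h
  have hsum : HasSum (fun n : ℤ ↦ ∫ x : ℝ in (0 : ℝ)..1, jacobiTheta₂_term n x τ)
      (∫ x : ℝ in (0 : ℝ)..1, jacobiTheta₂ x τ) := by
    refine intervalIntegral.hasSum_integral_of_dominated_convergence
      (fun n _ ↦ ‖jacobiTheta₂_term n 0 τ‖) (fun n ↦ ?_) (fun n ↦ ?_) ?_ ?_ ?_
    · exact Continuous.aestronglyMeasurable (by unfold jacobiTheta₂_term; fun_prop)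
    · exact .of_forall fun x _ ↦ by simp [norm_jacobiTheta₂_term]
    · exact .of_forall fun x _ ↦ ((summable_jacobiTheta₂_term_iff 0 τ).2 hτ).norm
    · simp
    · exact .of_forall fun x _ ↦ hasSum_jacobiTheta₂_term x hτ
  have hterm : ∀ n : ℤ, ∫ x : ℝ in (0 : ℝ)..1, jacobiTheta₂_term n x τ =
      if n = 0 then 1 else 0 := by
    intro n
    split_ifs with hn
    · simp [jacobiTheta₂_term, hn]
    · have hc : 2 * Real.pi * I * n ≠ 0 := by
        simp [Real.pi_ne_zero, hn]
      have he : cexp (2 * Real.pi * I * n) = 1 := by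
        rw [mul_comm]
        exact Complex.exp_int_mul_two_pi_mul_I n
      simp only [jacobiTheta₂_term, Complex.exp_add, intervalIntegral.integral_mul_const]
      rw [integral_exp_mul_complex hc]
      simp [he]
  simp only [hterm, h, intervalIntegral.integral_zero] at hsum
  exact one_ne_zero ((hasSum_ite_eq (0 : ℤ) (1 : ℂ)).unique hsum)

variable {τ : ℂ}

/-- The general term of the series `Theta τ u j`. -/
noncomputable def thetaTerm (τ u : ℂ) (j k : ℤ) : ℂ :=
  cexp (Real.pi * I * τ * (3 * (k : ℂ) + (j : ℂ)) ^ 2 / 3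
      + 2 * Real.pi * I * (3 * (k : ℂ) + (j : ℂ)) * u)

lemma im_three_mul_pos (hτ : 0 < τ.im) : 0 < (3 * τ).im := by
  simpa using hτ

lemma thetaTerm_eq (τ u : ℂ) (j k : ℤ) :
    thetaTerm τ u j k = cexp (Real.pi * I * τ * j ^ 2 / 3 + 2 * Real.pi * I * j * u) *
      jacobiTheta₂_term k (3 * u + j * τ) (3 * τ) := by
  rw [thetaTerm, jacobiTheta₂_term, ← Complex.exp_add]
  ring_nf

lemma Theta_eq (τ u : ℂ) (j : ℤ) :
    Theta τ u j = cexp (Real.pi * I * τ * j ^ 2 / 3 + 2 * Real.pi * I * j * u) *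
      jacobiTheta₂ (3 * u + j * τ) (3 * τ) := by
  rw [jacobiTheta₂, ← tsum_mul_left]
  exact tsum_congr fun k ↦ thetaTerm_eq τ u j k

lemma hasSum_thetaTerm (hτ : 0 < τ.im) (u : ℂ) (j : ℤ) :
    HasSum (thetaTerm τ u j) (Theta τ u j) := by
  rw [Theta_eq, funext (thetaTerm_eq τ u j)]
  exact (hasSum_jacobiTheta₂_term _ (im_three_mul_pos hτ)).mul_left _

lemma hasDerivAt_Theta (hτ : 0 < τ.im) (u : ℂ) (j : ℤ) :
    HasDerivAt (fun v ↦ Theta τ v j) (ThetaDeriv τ u j) u := by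
  have h3 := im_three_mul_pos hτ
  have hlin : HasDerivAt (fun v : ℂ ↦ 3 * v + j * τ) 3 u := by
    simpa using ((hasDerivAt_id u).const_mul 3).add_const (j * τ)
  have hexp : HasDerivAt
      (fun v : ℂ ↦ cexp (Real.pi * I * τ * j ^ 2 / 3 + 2 * Real.pi * I * j * v))
      (cexp (Real.pi * I * τ * j ^ 2 / 3 + 2 * Real.pi * I * j * u) * (2 * Real.pi * I * j)) u := by
    simpa using (((hasDerivAt_id u).const_mul (2 * Real.pi * I * j)).const_add
      (Real.pi * I * τ * j ^ 2 / 3)).cexp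
  have h := hexp.mul ((hasDerivAt_jacobiTheta₂_fst (3 * u + j * τ) h3).comp u hlin)
  rw [show (fun v ↦ Theta τ v j) = _ from funext fun v ↦ Theta_eq τ v j]
  refine h.congr_deriv ?_
  set E := cexp (Real.pi * I * τ * j ^ 2 / 3 + 2 * Real.pi * I * j * u) with hE
  have hs := ((hasSum_jacobiTheta₂_term (3 * u + j * τ) h3).mul_left
    (E * (2 * Real.pi * I * j))).add
    ((hasSum_jacobiTheta₂'_term (3 * u + j * τ) h3).mul_left (E * 3))
  have hk : ∀ k : ℤ, (2 * Real.pi * I * (3 * (k : ℂ) + (j : ℂ))) * thetaTerm τ u j k =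
      E * (2 * Real.pi * I * j) * jacobiTheta₂_term k (3 * u + j * τ) (3 * τ) +
        E * 3 * jacobiTheta₂'_term k (3 * u + j * τ) (3 * τ) := fun k ↦ by
    rw [thetaTerm_eq, ← hE, jacobiTheta₂'_term]
    ring
  rw [show ThetaDeriv τ u j = _ from (tsum_congr hk).trans hs.tsum_eq]
  simp only [Function.comp_apply]
  ring

lemma analyticOnNhd_Theta (hτ : 0 < τ.im) (j : ℤ) :
    AnalyticOnNhd ℂ (fun u ↦ Theta τ u j) Set.univ :=
  (show Differentiable ℂ fun u ↦ Theta τ u j from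
    fun u ↦ (hasDerivAt_Theta hτ u j).differentiableAt).differentiableOn.analyticOnNhd isOpen_univ

lemma exists_Theta_ne_zero (hτ : 0 < τ.im) (j : ℤ) : ∃ u, Theta τ u j ≠ 0 := by
  obtain ⟨z, hz⟩ := exists_jacobiTheta₂_ne_zero (im_three_mul_pos hτ)
  refine ⟨(z - j * τ) / 3, ?_⟩
  rw [Theta_eq, show 3 * ((z - j * τ) / 3) + j * τ = z by ring]
  exact mul_ne_zero (Complex.exp_ne_zero _) hz

lemma Theta_add_one_third (τ u : ℂ) (j : ℤ) :
    Theta τ (u + 1 / 3) j = cexp (2 * Real.pi * I / 3) ^ j * Theta τ u j := by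
  rw [Theta, Theta, ← tsum_mul_left]
  refine tsum_congr fun k ↦ ?_
  rw [← Complex.exp_int_mul, ← Complex.exp_add, Complex.exp_eq_exp_iff_exists_int]
  exact ⟨k, by ring⟩

lemma cube_root_relation : cexp (2 * Real.pi * I / 3) ^ 2 + cexp (2 * Real.pi * I / 3) + 1 = 0 := by
  have h := (Complex.isPrimitiveRoot_exp 3 three_ne_zero).geom_sum_eq_zero (by norm_num)
  simp only [Finset.sum_range_succ, Finset.sum_range_zero, Nat.cast_ofNat, pow_zero, pow_one] at h
  linear_combination h

/-- `Theta τ · 0` is not a linear combination of the other two theta functions. -/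
lemma exists_linear_combination_ne_zero (hτ : 0 < τ.im) (q r : ℂ) :
    ∃ u, Theta τ u 0 + q * Theta τ u 2 + r * Theta τ u 1 ≠ 0 := by
  by_contra! h
  obtain ⟨u, hu⟩ := exists_Theta_ne_zero hτ 0
  have h0 := h u
  have h1 := h (u + 1 / 3)
  have h2 := h (u + 1 / 3 + 1 / 3)
  simp only [Theta_add_one_third, zpow_ofNat] at h1 h2
  have hω := cube_root_relation
  set ω := cexp (2 * Real.pi * I / 3)
  apply hu
  linear_combination (h0 + h1 + h2) / 3
    - (r * Theta τ u 1 + q * Theta τ u 2 * (ω ^ 2 - ω + 1)) / 3 * hω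

lemma hasSum_mul_thetaTerm (hτ : 0 < τ.im) (u : ℂ) (i j l : ℤ) :
    HasSum (fun p : (ℤ × ℤ) × ℤ ↦
      thetaTerm τ u i p.1.1 * thetaTerm τ u j p.1.2 * thetaTerm τ u l p.2)
      (Theta τ u i * Theta τ u j * Theta τ u l) := by
  have hn (j : ℤ) := (hasSum_thetaTerm hτ u j).summable.norm
  have h2 := (hasSum_thetaTerm hτ u i).mul (hasSum_thetaTerm hτ u j)
    (summable_mul_of_summable_norm (hn i) (hn j))
  have h3 := summable_mul_of_summable_norm h2.summable.norm (hn l)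
  exact h2.mul (hasSum_thetaTerm hτ u l) h3

/-- The general term of the theta series of the `A₂` lattice. -/
noncomputable def hexTerm (τ : ℂ) (d e : ℤ) : ℂ :=
  cexp (Real.pi * I * τ * ((d : ℂ) ^ 2 + (e : ℂ) ^ 2 + ((d : ℂ) + (e : ℂ)) ^ 2) / 3)

/-- The theta series of a coset of three times the `A₂` lattice. -/
noncomputable def hexTheta (τ : ℂ) (r s : ℤ) : ℂ :=
  ∑' p : ℤ × ℤ, hexTerm τ (3 * p.1 + r) (3 * p.2 + s)

/-- Separate the barycentre `N` of a triple of indices from its deviations. -/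
lemma hasSum_Theta_mul (hτ : 0 < τ.im) (u : ℂ) {i j l n : ℤ} (hn : i + j + l = 3 * n) :
    HasSum (fun N : ℤ ↦ jacobiTheta₂_term N (3 * u) τ * hexTheta τ (i - N) (j - N))
      (Theta τ u i * Theta τ u j * Theta τ u l) := by
  let e : ℤ × (ℤ × ℤ) ≃ (ℤ × ℤ) × ℤ :=
    { toFun := fun p ↦ (p.2, p.1 - n - p.2.1 - p.2.2)
      invFun := fun p ↦ (p.2 + n + p.1.1 + p.1.2, p.1)
      left_inv := fun p ↦ by ext <;> dsimp only; omega
      right_inv := fun p ↦ by ext <;> dsimp only; omega }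
  have h := e.hasSum_iff.2 (hasSum_mul_thetaTerm hτ u i j l)
  have hterm : ∀ N : ℤ, ∀ p : ℤ × ℤ,
      thetaTerm τ u i p.1 * thetaTerm τ u j p.2 * thetaTerm τ u l (N - n - p.1 - p.2) =
      jacobiTheta₂_term N (3 * u) τ * hexTerm τ (3 * p.1 + (i - N)) (3 * p.2 + (j - N)) := by
    intro N p
    have hl : (l : ℂ) = 3 * n - i - j := by
      rw [show l = 3 * n - i - j by omega]
      push_cast
      ring
    simp only [thetaTerm, jacobiTheta₂_term, hexTerm, ← Complex.exp_add]
    push_cast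
    rw [hl]
    ring_nf
  refine h.prod_fiberwise fun N ↦ ?_
  rw [hexTheta, ← tsum_mul_left, ← tsum_congr (hterm N)]
  exact (h.summable.prod_factor N).hasSum

lemma hexTheta_add_three (τ : ℂ) (r s : ℤ) : hexTheta τ (r + 3) (s + 3) = hexTheta τ r s := by
  rw [hexTheta, hexTheta, ← ((Equiv.addRight (1 : ℤ)).prodCongr (Equiv.addRight (1 : ℤ))).tsum_eq
    fun p : ℤ × ℤ ↦ hexTerm τ (3 * p.1 + r) (3 * p.2 + s)]
  refine tsum_congr fun p ↦ ?_
  simp only [Equiv.prodCongr_apply, Prod.map_fst, Prod.map_snd, Equiv.coe_addRight]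
  ring_nf

/-- Rotational symmetry of the `A₂` lattice. -/
lemma hexTheta_succ (τ : ℂ) (r : ℤ) : hexTheta τ (r + 1) (r + 2) = hexTheta τ r (r + 1) := by
  let e : ℤ × ℤ ≃ ℤ × ℤ :=
    { toFun := fun p ↦ (-p.1 - p.2 - r - 1, p.1)
      invFun := fun p ↦ (p.2, -p.1 - p.2 - r - 1)
      left_inv := fun p ↦ by ext <;> dsimp only; omega
      right_inv := fun p ↦ by ext <;> dsimp only; omega }
  rw [hexTheta, hexTheta, ← e.tsum_eq fun p : ℤ × ℤ ↦ hexTerm τ (3 * p.1 + r) (3 * p.2 + (r + 1))]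
  refine tsum_congr fun p ↦ ?_
  simp only [hexTerm, e, Equiv.coe_fn_mk]
  push_cast
  ring_nf

lemma hexTheta_consecutive (τ : ℂ) (r : ℤ) : hexTheta τ r (r + 1) = hexTheta τ 0 1 := by
  induction r with
  | zero => rfl
  | succ k ih => rw [add_assoc, one_add_one_eq_two, hexTheta_succ, ih]
  | pred k ih => rw [← ih, ← hexTheta_succ]; ring_nf

lemma hexTheta_diagonal_sum (τ : ℂ) (r : ℤ) :
    hexTheta τ (0 - r) (0 - r) + hexTheta τ (2 - r) (2 - r) + hexTheta τ (1 - r) (1 - r) =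
      hexTheta τ 0 0 + hexTheta τ 2 2 + hexTheta τ 1 1 := by
  have hstep : ∀ s : ℤ, hexTheta τ (s + 1) (s + 1) + hexTheta τ (s + 3) (s + 3) +
      hexTheta τ (s + 2) (s + 2) = hexTheta τ s s + hexTheta τ (s + 2) (s + 2) +
      hexTheta τ (s + 1) (s + 1) := by
    intro s
    rw [hexTheta_add_three]
    ring
  induction r with
  | zero => simp
  | succ k ih =>
    rw [← ih]
    convert (hstep (-1 - k)).symm using 4 <;> ring
  | pred k ih =>
    rw [← ih]
    convert hstep k using 4 <;> ring

lemma Theta_mul_eq (hτ : 0 < τ.im) (u : ℂ) :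
    Theta τ u 0 * Theta τ u 2 * Theta τ u 1 = jacobiTheta₂ (3 * u) τ * hexTheta τ 0 1 := by
  have h := hasSum_Theta_mul hτ u (i := 0) (j := 1) (l := 2) (n := 1) (by norm_num)
  have hc : ∀ N : ℤ, hexTheta τ (0 - N) (1 - N) = hexTheta τ 0 1 := fun N ↦ by
    rw [← hexTheta_consecutive τ (0 - N)]
    ring_nf
  simp only [hc] at h
  rw [((hasSum_jacobiTheta₂_term (3 * u) hτ).mul_right _).unique h]
  ring

lemma Theta_cube_sum_eq (hτ : 0 < τ.im) (u : ℂ) :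
    Theta τ u 0 ^ 3 + Theta τ u 2 ^ 3 + Theta τ u 1 ^ 3 =
      jacobiTheta₂ (3 * u) τ * (hexTheta τ 0 0 + hexTheta τ 2 2 + hexTheta τ 1 1) := by
  have h (j : ℤ) := hasSum_Theta_mul hτ u (i := j) (j := j) (l := j) (n := j) (by ring)
  have hs := ((h 0).add (h 2)).add (h 1)
  simp only [← mul_add, hexTheta_diagonal_sum] at hs
  rw [((hasSum_jacobiTheta₂_term (3 * u) hτ).mul_right _).unique hs]
  ring

lemma Theta_mul_not_identically_zero (hτ : 0 < τ.im) :
    ∃ u, Theta τ u 0 * Theta τ u 2 * Theta τ u 1 ≠ 0 := by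
  by_contra! h
  have ha (j : ℤ) := analyticOnNhd_Theta hτ j
  rcases ((ha 0).mul (ha 2)).eq_zero_or_eq_zero_of_mul_eq_zero (ha 1) (fun u _ ↦ h u)
    isPreconnected_univ with h | h
  · rcases (ha 0).eq_zero_or_eq_zero_of_mul_eq_zero (ha 2) h isPreconnected_univ with h | h
    · exact (exists_Theta_ne_zero hτ 0).elim fun u hu ↦ hu (h u trivial)
    · exact (exists_Theta_ne_zero hτ 2).elim fun u hu ↦ hu (h u trivial)
  · exact (exists_Theta_ne_zero hτ 1).elim fun u hu ↦ hu (h u trivial)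

/-- The theta functions parametrize a member of the Hesse pencil. -/
lemma exists_hesse_cubic (hτ : 0 < τ.im) :
    ∃ lam : ℂ, ∀ u, Theta τ u 0 ^ 3 + Theta τ u 2 ^ 3 + Theta τ u 1 ^ 3 =
      lam * (Theta τ u 0 * Theta τ u 2 * Theta τ u 1) := by
  have hD : hexTheta τ 0 1 ≠ 0 := by
    intro h0
    obtain ⟨u, hu⟩ := Theta_mul_not_identically_zero hτ
    exact hu (by rw [Theta_mul_eq hτ, h0, mul_zero])
  refine ⟨(hexTheta τ 0 0 + hexTheta τ 2 2 + hexTheta τ 1 1) / hexTheta τ 0 1, fun u ↦ ?_⟩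
  rw [Theta_cube_sum_eq hτ, Theta_mul_eq hτ]
  field_simp

/-- The member of the Hesse pencil parametrized by the theta functions is smooth. -/
lemma hesse_parameter_ne (hτ : 0 < τ.im) {lam : ℂ}
    (h : ∀ u, Theta τ u 0 ^ 3 + Theta τ u 2 ^ 3 + Theta τ u 1 ^ 3 =
      lam * (Theta τ u 0 * Theta τ u 2 * Theta τ u 1)) : lam ^ 3 ≠ 27 := by
  intro hlam
  have hω := cube_root_relation
  set ω := cexp (2 * Real.pi * I / 3)
  have han (q r : ℂ) : AnalyticOnNhd ℂ
      (fun u ↦ Theta τ u 0 + q * Theta τ u 2 + r * Theta τ u 1) Set.univ :=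
    ((analyticOnNhd_Theta hτ 0).add (analyticOnNhd_const.mul (analyticOnNhd_Theta hτ 2))).add
      (analyticOnNhd_const.mul (analyticOnNhd_Theta hτ 1))
  have hne {q r : ℂ} (h : ∀ u ∈ Set.univ, Theta τ u 0 + q * Theta τ u 2 + r * Theta τ u 1 = 0) :
      False :=
    (exists_linear_combination_ne_zero hτ q r).elim fun u hu ↦ hu (h u trivial)
  have hprod : ∀ u ∈ Set.univ,
      (Theta τ u 0 + 1 * Theta τ u 2 + lam / 3 * Theta τ u 1) *
      (Theta τ u 0 + ω * Theta τ u 2 + ω ^ 2 * (lam / 3) * Theta τ u 1) *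
      (Theta τ u 0 + ω ^ 2 * Theta τ u 2 + ω * (lam / 3) * Theta τ u 1) = 0 := by
    intro u _
    linear_combination h u + Theta τ u 1 ^ 3 / 27 * hlam
      + (Theta τ u 0 + Theta τ u 2 + lam / 3 * Theta τ u 1) *
        ((ω - 1) * (Theta τ u 2 ^ 2 + (lam / 3 * Theta τ u 1) ^ 2) + Theta τ u 0 * Theta τ u 2
          + Theta τ u 0 * (lam / 3 * Theta τ u 1)
          + (ω ^ 2 - ω + 1) * Theta τ u 2 * (lam / 3 * Theta τ u 1)) * hω
  rcases ((han _ _).mul (han _ _)).eq_zero_or_eq_zero_of_mul_eq_zero (han _ _) hprod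
    isPreconnected_univ with h | h
  · rcases (han _ _).eq_zero_or_eq_zero_of_mul_eq_zero (han _ _) h isPreconnected_univ with h | h
    · exact hne h
    · exact hne h
  · exact hne h

lemma analyticOnNhd_jacobiTheta₂_comp (hτ : 0 < τ.im) {f : ℂ → ℂ} (hf : Differentiable ℂ f) :
    AnalyticOnNhd ℂ (fun v ↦ jacobiTheta₂ (f v) τ) Set.univ :=
  (show Differentiable ℂ fun v ↦ jacobiTheta₂ (f v) τ from
    fun v ↦ (differentiableAt_jacobiTheta₂_fst (f v) hτ).fun_comp' v
      (hf v)).differentiableOn.analyticOnNhd isOpen_univ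

/-- The three theta functions have no common zero. -/
lemma Theta_no_common_zero (hτ : 0 < τ.im) (u : ℂ) :
    ¬(Theta τ u 0 = 0 ∧ Theta τ u 2 = 0 ∧ Theta τ u 1 = 0) := by
  rintro ⟨h0, h2, h1⟩
  have hτ2 : 0 < (τ / 2).im := by
    rw [show τ / 2 = ((1 / 2 : ℝ) : ℂ) * τ by push_cast; ring, Complex.im_ofReal_mul]
    positivity
  let e : Fin 3 × (ℤ × ℤ) ≃ ℤ × ℤ :=
    (((Equiv.prodAssoc _ _ _).symm.trans
      (((Equiv.prodComm _ _).trans (Int.divModEquiv 3).symm).prodCongr (Equiv.refl ℤ)))).trans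
    { toFun := fun p ↦ (p.1 / 3 + p.2, p.1 - p.1 / 3 - p.2)
      invFun := fun p ↦ (p.1 + p.2, p.1 - (p.1 + p.2) / 3)
      left_inv := fun p ↦ by ext <;> dsimp only <;> omega
      right_inv := fun p ↦ by ext <;> dsimp only <;> omega }
  have he : ∀ (j : Fin 3) (k d : ℤ), e (j, k, d) = (k + d, 2 * k + (j : ℕ) - d) := by
    intro j k d
    have hj : (3 * k + (j : ℕ)) / 3 = k := by omega
    simp [e, Int.divModEquiv]
    omega
  have hzero : ∀ α : ℂ, jacobiTheta₂ (u - α) τ * jacobiTheta₂ (u + α / 2) (τ / 2) = 0 := by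
    intro α
    have hs1 := hasSum_jacobiTheta₂_term (u - α) hτ
    have hs2 := hasSum_jacobiTheta₂_term (u + α / 2) hτ2
    have hs12 := summable_mul_of_summable_norm hs1.summable.norm hs2.summable.norm
    set K : Fin 3 → ℤ → ℂ := fun j d ↦ cexp (-(Real.pi * I * τ * (j : ℕ) ^ 2 / 3)
          + Real.pi * I * τ * (d ^ 2 + ((j : ℕ) - d) ^ 2 / 2)
          + Real.pi * I * α * ((j : ℕ) - 3 * d)) with hK
    have hterm : ∀ p : Fin 3 × (ℤ × ℤ),
        jacobiTheta₂_term (e p).1 (u - α) τ * jacobiTheta₂_term (e p).2 (u + α / 2) (τ / 2) =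
        K p.1 p.2.2 * thetaTerm τ u (p.1 : ℕ) p.2.1 := by
      rintro ⟨j, k, d⟩
      simp only [he, hK, thetaTerm, jacobiTheta₂_term, ← Complex.exp_add]
      push_cast
      ring_nf
    have h : HasSum (fun p : Fin 3 × (ℤ × ℤ) ↦ K p.1 p.2.2 * thetaTerm τ u (p.1 : ℕ) p.2.1)
        (jacobiTheta₂ (u - α) τ * jacobiTheta₂ (u + α / 2) (τ / 2)) :=
      funext hterm ▸ e.hasSum_iff.2 (hs1.mul hs2 hs12)
    have hTheta : ∀ j : Fin 3, Theta τ u (j : ℕ) = 0 := by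
      intro j
      fin_cases j
      · exact h0
      · exact h1
      · exact h2
    refine (h.prod_fiberwise (g := fun _ ↦ 0) fun j ↦ ?_).unique hasSum_zero
    have hj := (h.summable.prod_factor j).hasSum
    have hj0 : HasSum (fun _ : ℤ ↦ (0 : ℂ))
        (∑' p : ℤ × ℤ, K j p.2 * thetaTerm τ u (j : ℕ) p.1) := by
      refine ((Equiv.prodComm ℤ ℤ).hasSum_iff.2 hj).prod_fiberwise fun d ↦ ?_
      have hd := (hasSum_thetaTerm hτ u (j : ℕ)).mul_left (K j d)
      rwa [hTheta, mul_zero] at hd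
    rwa [hj0.unique hasSum_zero] at hj
  have han1 := analyticOnNhd_jacobiTheta₂_comp hτ (f := fun α ↦ u - α) (by fun_prop)
  have han2 := analyticOnNhd_jacobiTheta₂_comp hτ2 (f := fun α ↦ u + α / 2) (by fun_prop)
  rcases han1.eq_zero_or_eq_zero_of_mul_eq_zero han2 (fun α _ ↦ hzero α) isPreconnected_univ
    with h | h
  · obtain ⟨z, hz⟩ := exists_jacobiTheta₂_ne_zero hτ
    exact hz (by simpa using h (u - z) trivial)
  · obtain ⟨z, hz⟩ := exists_jacobiTheta₂_ne_zero hτ2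
    refine hz ?_
    rw [← h (2 * (z - u)) trivial]
    ring_nf

end ThetaFunctions

lemma tangent_hesse_cubic {τ lam : ℂ} (hτ : 0 < τ.im)
    (h : ∀ u, Theta τ u 0 ^ 3 + Theta τ u 2 ^ 3 + Theta τ u 1 ^ 3 =
      lam * (Theta τ u 0 * Theta τ u 2 * Theta τ u 1)) (u : ℂ) :
    3 * (Theta τ u 0 ^ 2 * ThetaDeriv τ u 0 + Theta τ u 2 ^ 2 * ThetaDeriv τ u 2
        + Theta τ u 1 ^ 2 * ThetaDeriv τ u 1) =
      lam * (Theta τ u 2 * Theta τ u 1 * ThetaDeriv τ u 0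
        + Theta τ u 0 * Theta τ u 1 * ThetaDeriv τ u 2
        + Theta τ u 0 * Theta τ u 2 * ThetaDeriv τ u 1) := by
  have hd (j : ℤ) := hasDerivAt_Theta hτ u j
  have hl := (((hd 0).fun_pow 3).fun_add ((hd 2).fun_pow 3)).fun_add ((hd 1).fun_pow 3)
  have hr := (((hd 0).fun_mul (hd 2)).fun_mul (hd 1)).const_mul lam
  rw [funext h] at hl
  have := hl.unique hr
  push_cast at this
  linear_combination this

lemma Sky_relations (a b c : ℂ) :
    a • (skX a b c * skY a b c) + b • (skY a b c * skX a b c) + c • (skZ a b c * skZ a b c) = 0 ∧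
    a • (skY a b c * skZ a b c) + b • (skZ a b c * skY a b c) + c • (skX a b c * skX a b c) = 0 ∧
    a • (skZ a b c * skX a b c) + b • (skX a b c * skZ a b c) + c • (skY a b c * skY a b c) = 0 := by
  refine ⟨?_, ?_, ?_⟩
  · simpa [skX, skY, skZ] using RingQuot.mkAlgHom_rel ℂ (SklyRel.rel_xy (a := a) (b := b) (c := c))
  · simpa [skX, skY, skZ] using RingQuot.mkAlgHom_rel ℂ (SklyRel.rel_yz (a := a) (b := b) (c := c))
  · simpa [skX, skY, skZ] using RingQuot.mkAlgHom_rel ℂ (SklyRel.rel_zx (a := a) (b := b) (c := c))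

/-- An element commuting with the three generators is central. -/
lemma Sky_commute {a b c : ℂ} {w : Sky a b c} (hx : Commute w (skX a b c))
    (hy : Commute w (skY a b c)) (hz : Commute w (skZ a b c)) (r : Sky a b c) : Commute w r := by
  obtain ⟨f, rfl⟩ := RingQuot.mkAlgHom_surjective ℂ (SklyRel a b c) r
  induction f using FreeAlgebra.induction with
  | grade0 t =>
    rw [AlgHom.commutes]
    exact (Algebra.commutes t w).symm
  | grade1 i =>
    fin_cases i
    · exact hx
    · exact hy
    · exact hz
  | mul p q hp hq =>
    rw [map_mul]
    exact hp.mul_right hq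
  | add p q hp hq =>
    rw [map_add]
    exact hp.add_right hq

/-- for every `u ∈ ℂ`, the worldsheet superpotential `W` is central in
the Sklyanin algebra `Sky₃(a(u), b(u), c(u))`. -/
theorem sklyW_central (τ : ℂ) (hτ : 0 < τ.im) (u : ℂ)
    (r : Sky (Theta τ u 0) (Theta τ u 2) (Theta τ u 1)) :
    sklyW τ u * r = r * sklyW τ u := by
  obtain ⟨lam, hlam⟩ := exists_hesse_cubic hτ
  have h27 := hesse_parameter_ne hτ hlam
  have h0 := Theta_no_common_zero hτ u
  have hT := tangent_hesse_cubic hτ hlam u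
  obtain ⟨hxy, hyz, hzx⟩ := Sky_relations (Theta τ u 0) (Theta τ u 2) (Theta τ u 1)
  have hx := commute_cyclicCubic h0 h27 (hlam u) hT hxy hyz hzx
  have hy := commute_cyclicCubic h0 h27 (hlam u) hT hyz hzx hxy
  have hz := commute_cyclicCubic h0 h27 (hlam u) hT hzx hxy hyz
  rw [cyclicCubic_rotate] at hy
  rw [← cyclicCubic_rotate] at hz
  exact Sky_commute (w := sklyW τ u) hx hy hz r
end

section
/- For all u, u' ∈ ℂ, the equality Θ₀(u + τ/4)·Θ₁(u' + τ/4) = Θ₁(u + τ/4)·Θ₀(u' + τ/4) holds if and only if u' − u ∈ Λ_τ or u' + u − (1 + τ/2) ∈ Λ_τ. (That is, the degree-two map Φ₂ : ℂ/Λ_τ → ℙ¹, u ↦ (Θ₀(u + τ/4) : −iΘ₁(u + τ/4)), is a branched double cover whose fiber through u is {u, 1 + τ/2 − u}.) -/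
open Complex

/-- `Θ₀(u) = θ[0,0](2u,2τ) = ∑_{m∈ℤ} exp(2πiτm² + 4πimu)`. -/
noncomputable def Th0 (τ u : ℂ) : ℂ :=
  ∑' m : ℤ, Complex.exp (2 * Real.pi * I * τ * (m : ℂ) ^ 2
      + 4 * Real.pi * I * (m : ℂ) * u)

/-- `Θ₁(u) = θ[1/2,0](2u,2τ) = ∑_{m∈ℤ} exp(2πiτ(m+1/2)² + 4πi(m+1/2)u)`. -/
noncomputable def Th1 (τ u : ℂ) : ℂ :=
  ∑' m : ℤ, Complex.exp (2 * Real.pi * I * τ * ((m : ℂ) + 1 / 2) ^ 2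
      + 4 * Real.pi * I * ((m : ℂ) + 1 / 2) * u)

/-- Membership in the lattice `Λ_τ = ℤ + ℤτ ⊂ ℂ`. -/
def inLattice (τ z : ℂ) : Prop := ∃ m n : ℤ, z = (m : ℂ) + (n : ℂ) * τ

/-- The finite `q`-binomial theorem; `a n` is the `q²`-Pochhammer symbol `(q²; q²)ₙ`. -/
theorem qBinomial_prod_eq_sum {K : Type*} [Field K] (a : ℕ → K) (q : K) (ha : ∀ n, a n ≠ 0)
    (h0 : a 0 = 1)
    (hs : ∀ n, a (n+1) = a n * (1 - q^(2*(n+1)))) (x : K) (M : ℕ) :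
    ∏ k ∈ Finset.range M, (1 + x * q^(2*k)) =
      ∑ k ∈ Finset.range (M+1), a M / (a k * a (M-k)) * q^(k*(k-1)) * x^k := by
  induction M with
  | zero => simp [h0]
  | succ M ih =>
    rw [Finset.prod_range_succ, ih, mul_add, mul_one]
    nth_rw 1 [Finset.sum_range_succ']
    nth_rw 1 [Finset.sum_range_succ]
    rw [Finset.sum_range_succ', Finset.sum_range_succ, add_mul, Finset.sum_mul]
    have key : ∀ k ∈ Finset.range M, a M / (a (k+1) * a (M-(k+1))) * q^((k+1)*(k+1-1)) * x^(k+1)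
        + a M / (a k * a (M-k)) * q^(k*(k-1)) * x^k * (x * q^(2*M))
        = a (M+1) / (a (k+1) * a (M+1-(k+1))) * q^((k+1)*(k+1-1)) * x^(k+1) := by
      intro k hk
      obtain ⟨d, rfl⟩ := Nat.exists_eq_add_of_lt (Finset.mem_range.1 hk)
      have e1 : k + d + 1 - (k+1) = d := by omega
      have e2 : k + d + 1 - k = d + 1 := by omega
      have e3 : k + d + 1 + 1 - (k+1) = d + 1 := by omega
      have e4 : (k+1)*(k+1-1) = k*(k-1) + 2*k := by
        cases k <;> simp; ring
      rw [e1, e2, e3, e4, hs (k+d+1), hs k, hs d]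
      have hk1 := ha (k+1); have hd1 := ha (d+1)
      rw [hs] at hk1 hd1
      have := right_ne_zero_of_mul hk1
      have := right_ne_zero_of_mul hd1
      have := ha k; have := ha d
      field_simp
      ring
    rw [← Finset.sum_congr rfl key, Finset.sum_add_distrib]
    have e5 : (M+1)*(M+1-1) = M*(M-1) + 2*M := by
      cases M <;> simp; ring
    have := ha M; have := ha (M+1)
    rw [e5]
    simp [h0, ha]
    ring

/-- The finite form of the Jacobi triple product. -/
theorem finite_jacobi_triple_product {K : Type*} [Field K] (a : ℕ → K) (q : K) (ha : ∀ n, a n ≠ 0)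
    (h0 : a 0 = 1)
    (hs : ∀ n, a (n+1) = a n * (1 - q^(2*(n+1)))) (hq : q ≠ 0) {y : K} (hy : y ≠ 0) (N : ℕ) :
    ∏ k ∈ Finset.range N, ((1 + q^(2*k+1) * y) * (1 + q^(2*k+1) * y⁻¹)) =
      ∑ k ∈ Finset.range (2*N+1),
        a (2*N) / (a k * a (2*N-k)) * (q^(((k:ℤ)-N)^2) * y^((k:ℤ)-N)) := by
  have hprod : ∀ N : ℕ, ∏ i ∈ Finset.range N, (y * (q^(2*i+1))⁻¹) = y^N * (q^(N^2))⁻¹ := by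
    intro N
    induction N with
    | zero => simp
    | succ N ih =>
      rw [Finset.prod_range_succ, ih]
      field_simp
      ring
  have hC : y^N * (q^(N^2))⁻¹ ≠ 0 := by positivity
  have h := qBinomial_prod_eq_sum a q ha h0 hs (y * (q^(2*N))⁻¹ * q) (2*N)
  rw [two_mul N, Finset.prod_range_add, ← Finset.prod_range_reflect, ← two_mul N] at h
  apply mul_left_cancel₀ hC
  rw [Finset.mul_sum, Finset.prod_mul_distrib, ← hprod, mul_left_comm, ← Finset.prod_mul_distrib,
    mul_comm]
  convert h using 2
  · refine Finset.prod_congr rfl fun i hi ↦ ?_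
    obtain ⟨d, rfl⟩ := Nat.exists_eq_add_of_lt (Finset.mem_range.1 hi)
    rw [show i + d + 1 - 1 - i = d by omega]
    field_simp
    ring
  · refine Finset.prod_congr rfl fun i hi ↦ ?_
    field_simp
    ring
  · rename_i k hk
    rw [hprod, mul_left_comm, mul_assoc (_ / _)]
    congr 1
    have e1 : q ^ (k*(k-1)) = q ^ ((k:ℤ)*(k-1)) := by
      rw [← zpow_natCast]; congr 1
      cases k <;> simp
    rw [e1, ← zpow_natCast (_ * q) k]
    simp only [mul_zpow, ← zpow_natCast q, ← zpow_natCast y, ← zpow_mul, ← zpow_neg]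
    rw [mul_comm (q ^ ((k:ℤ) - N)^2), mul_mul_mul_comm, ← zpow_add₀ hy, ← zpow_add₀ hq]
    rw [mul_assoc, ← zpow_add₀ hq, mul_left_comm, ← zpow_add₀ hq]
    push_cast
    congr 2 <;> ring

open Filter Topology in
/-- The Jacobi triple product, with an unspecified nonzero constant. -/
theorem exists_jacobiTheta₂_eq_mul_tprod {τ : ℂ} (hτ : 0 < τ.im) (z : ℂ) :
    ∃ c : ℂ, c ≠ 0 ∧ jacobiTheta₂ z τ = c *
      ((∏' k : ℕ, (1 + cexp (Real.pi * I * τ)^(2*k+1) * cexp (2 * Real.pi * I * z))) *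
       (∏' k : ℕ, (1 + cexp (Real.pi * I * τ)^(2*k+1) * (cexp (2 * Real.pi * I * z))⁻¹))) := by
  set q := cexp (Real.pi * I * τ) with hqdef
  set y := cexp (2 * Real.pi * I * z) with hydef
  have hq0 : q ≠ 0 := exp_ne_zero _
  have hy0 : y ≠ 0 := exp_ne_zero _
  have hq1 : ‖q‖ < 1 := by
    rw [hqdef, Complex.norm_exp]
    simpa using mul_pos Real.pi_pos hτ
  have hsum : ∀ w : ℂ, Summable fun k : ℕ ↦ ‖q^(2*k+1) * w‖ := by
    intro w
    have := (summable_geometric_of_lt_one (norm_nonneg q) hq1).comp_injective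
      (i := fun k : ℕ ↦ 2*k+1) (fun a b h ↦ by simpa using h)
    simpa [norm_mul, norm_pow] using this.mul_right ‖w‖
  have hpne : ∀ k : ℕ, 1 + q^(2*k+1) * (-q) ≠ 0 := by
    intro k h
    have h2 : q^(2*k+2) = 1 := by linear_combination -h
    have : ‖q‖^(2*k+2) < 1 := pow_lt_one₀ (norm_nonneg q) hq1 (by omega)
    rw [← norm_pow, h2] at this
    simp at this
  have hlim : ∀ w : ℂ, Tendsto (fun n ↦ ∏ k ∈ Finset.range n, (1 + q^(2*k+1) * w)) atTop
      (𝓝 (∏' k : ℕ, (1 + q^(2*k+1) * w))) := fun w ↦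
    (multipliable_one_add_of_summable (hsum w)).hasProd.tendsto_prod_nat
  set a : ℕ → ℂ := fun n ↦ ∏ k ∈ Finset.range n, (1 + q^(2*k+1) * (-q)) with hadef
  set L := ∏' k : ℕ, (1 + q^(2*k+1) * (-q)) with hL
  have ha : Tendsto a atTop (𝓝 L) := hlim (-q)
  have hL0 : L ≠ 0 := tprod_one_add_ne_zero_of_summable hpne (hsum _)
  have ha0 : ∀ n, a n ≠ 0 := fun n ↦ Finset.prod_ne_zero_iff.2 fun k _ ↦ hpne k
  have has : ∀ n, a (n+1) = a n * (1 - q^(2*(n+1))) := by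
    intro n
    simp only [hadef, Finset.prod_range_succ]
    ring
  obtain ⟨A, hA⟩ := ha.norm.bddAbove_range
  obtain ⟨B, hB⟩ := (ha.inv₀ hL0).norm.bddAbove_range
  have hA : ∀ n, ‖a n‖ ≤ A := fun n ↦ hA ⟨n, rfl⟩
  have hB : ∀ n, ‖(a n)⁻¹‖ ≤ B := fun n ↦ hB ⟨n, rfl⟩
  have hA0 : 0 ≤ A := (norm_nonneg _).trans (hA 0)
  have hB0 : 0 ≤ B := (norm_nonneg _).trans (hB 0)
  have hterm : ∀ j : ℤ, jacobiTheta₂_term j z τ = q^(j^2) * y^j := by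
    intro j
    rw [jacobiTheta₂_term, hqdef, hydef, ← exp_int_mul, ← exp_int_mul, ← Complex.exp_add]
    congr 1; push_cast; ring
  let f : ℕ → ℤ → ℂ := fun N j ↦ if j ∈ Finset.Icc (-(N:ℤ)) N then
    a (2*N) * ((a (N+j).toNat)⁻¹ * (a (N-j).toNat)⁻¹) * jacobiTheta₂_term j z τ else 0
  have hf : ∀ N, ∑' j, f N j =
      ∏ k ∈ Finset.range N, ((1 + q^(2*k+1) * y) * (1 + q^(2*k+1) * y⁻¹)) := by
    intro N
    rw [finite_jacobi_triple_product a q ha0 (by simp [hadef]) has hq0 hy0,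
      tsum_eq_sum (s := Finset.Icc (-(N:ℤ)) N)
      (fun j hj ↦ if_neg hj)]
    symm
    refine Finset.sum_nbij' (fun k ↦ (k:ℤ) - N) (fun j ↦ (N + j).toNat) ?_ ?_ ?_ ?_ ?_
    · intro k hk; simp at hk ⊢; omega
    · intro k hk; simp at hk ⊢; omega
    · intro k hk; simp
    · intro k hk; simp at hk ⊢; omega
    · intro k hk
      have : (k:ℤ) - N ∈ Finset.Icc (-(N:ℤ)) N := by simp at hk ⊢; omega
      simp only [if_pos this, hterm]
      rw [show ((N:ℤ) + (k - N)).toNat = k by omega,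
        show ((N:ℤ) - (k - N)).toNat = 2*N-k by omega, div_eq_mul_inv, mul_inv]
  have hT : Tendsto (fun N ↦ ∑' j, f N j) atTop
      (𝓝 (∑' j, L * (L⁻¹ * L⁻¹) * jacobiTheta₂_term j z τ)) := by
    refine tendsto_tsum_of_dominated_convergence
      (bound := fun j ↦ A * (B * B) * ‖jacobiTheta₂_term j z τ‖) ?_ ?_ ?_
    · exact ((summable_jacobiTheta₂_term_iff z τ).2 hτ).norm.mul_left _
    · intro j
      have h1 : Tendsto (fun N : ℕ ↦ 2*N) atTop atTop :=
        tendsto_atTop_mono (fun N ↦ Nat.le_mul_of_pos_left N two_pos) tendsto_id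
      have h2 : Tendsto (fun N : ℕ ↦ ((N:ℤ)+j).toNat) atTop atTop :=
        tendsto_atTop_mono (f := fun N : ℕ ↦ N - j.natAbs) (fun N ↦ by omega)
          (tendsto_sub_atTop_nat _)
      have h3 : Tendsto (fun N : ℕ ↦ ((N:ℤ)-j).toNat) atTop atTop :=
        tendsto_atTop_mono (f := fun N : ℕ ↦ N - j.natAbs) (fun N ↦ by omega)
          (tendsto_sub_atTop_nat _)
      have := ((ha.comp h1).mul (((ha.inv₀ hL0).comp h2).mul ((ha.inv₀ hL0).comp h3))).mul_const
        (jacobiTheta₂_term j z τ)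
      refine this.congr' ?_
      filter_upwards [eventually_ge_atTop j.natAbs] with N hN
      have : j ∈ Finset.Icc (-(N:ℤ)) N := by simp; omega
      simp only [f, if_pos this, Function.comp]
    · refine Eventually.of_forall fun N j ↦ ?_
      simp only [f]
      split_ifs
      · rw [norm_mul, norm_mul, norm_mul]
        gcongr
        exacts [hA _, hB _, hB _]
      · rw [norm_zero]; positivity
  rw [tsum_mul_left] at hT
  have hT' := (hlim y).mul (hlim y⁻¹)
  simp only [← Finset.prod_mul_distrib, ← hf] at hT'
  refine ⟨L, hL0, ?_⟩
  rw [← tendsto_nhds_unique hT hT', jacobiTheta₂]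
  field_simp

/-- The zeros of `jacobiTheta₂ · τ` are the translates of `(1 + τ) / 2` by the lattice. -/
theorem jacobiTheta₂_eq_zero_iff {τ : ℂ} (hτ : 0 < τ.im) (z : ℂ) :
    jacobiTheta₂ z τ = 0 ↔ ∃ m n : ℤ, z = 1 / 2 + τ / 2 + m + n * τ := by
  have hq1 : ‖cexp (Real.pi * I * τ)‖ < 1 := by
    rw [Complex.norm_exp]
    simpa using mul_pos Real.pi_pos hτ
  have hne : ∀ w : ℂ, (∏' k : ℕ, (1 + cexp (Real.pi * I * τ)^(2*k+1) * w)) = 0 ↔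
      ∃ k : ℕ, 1 + cexp (Real.pi * I * τ)^(2*k+1) * w = 0 := by
    intro w
    refine ⟨fun h ↦ ?_, tprod_of_exists_eq_zero⟩
    by_contra! hc
    refine tprod_one_add_ne_zero_of_summable hc ?_ h
    have := (summable_geometric_of_lt_one (norm_nonneg _) hq1).comp_injective
      (i := fun k : ℕ ↦ 2*k+1) (fun a b h ↦ by simpa using h)
    simpa [norm_mul, norm_pow] using this.mul_right ‖w‖
  have hfac : ∀ (k : ℕ) (w : ℂ), 1 + cexp (Real.pi * I * τ)^(2*k+1) * cexp (2 * Real.pi * I * w) = 0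
      ↔ ∃ m : ℤ, w = 1 / 2 + m - (2 * k + 1) / 2 * τ := by
    intro k w
    have hpi : (Real.pi : ℂ) * I ≠ 0 := by simp [Real.pi_ne_zero]
    rw [← Complex.exp_nat_mul, ← Complex.exp_add, add_comm, ← eq_neg_iff_add_eq_zero,
      ← Complex.exp_pi_mul_I, exp_eq_exp_iff_exists_int]
    refine exists_congr fun m ↦ ⟨fun h ↦ ?_, fun h ↦ ?_⟩
    · apply mul_left_cancel₀ hpi
      push_cast at h
      linear_combination h / 2
    · rw [h]; push_cast; ring
  obtain ⟨c, hc, h⟩ := exists_jacobiTheta₂_eq_mul_tprod hτ z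
  have hinv : (cexp (2 * Real.pi * I * z))⁻¹ = cexp (2 * Real.pi * I * (-z)) := by
    rw [mul_neg, Complex.exp_neg]
  simp only [h, mul_eq_zero, hc, false_or, hne, hinv, hfac]
  constructor
  · rintro (⟨k, m, h⟩ | ⟨k, m, h⟩)
    · exact ⟨m, -k - 1, by rw [h]; push_cast; ring⟩
    · exact ⟨-m - 1, k, by push_cast; linear_combination -h⟩
  · rintro ⟨m, n, h⟩
    rcases n with n | n
    · exact .inr ⟨n, -m - 1, by rw [h, Int.ofNat_eq_natCast]; push_cast; ring⟩
    · exact .inl ⟨n, m, by rw [h]; push_cast; ring⟩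

theorem hasSum_Th0 {τ : ℂ} (hτ : 0 < τ.im) (v : ℂ) :
    HasSum (fun m : ℤ ↦ cexp (2 * Real.pi * I * τ * (m : ℂ) ^ 2 + 4 * Real.pi * I * (m : ℂ) * v))
      (Th0 τ v) := by
  have h2 : 0 < (2 * τ).im := by simpa using hτ
  refine Summable.hasSum (((summable_jacobiTheta₂_term_iff (2 * v) (2 * τ)).2 h2).congr fun m ↦ ?_)
  rw [jacobiTheta₂_term]
  congr 1; ring

theorem hasSum_Th1 {τ : ℂ} (hτ : 0 < τ.im) (v : ℂ) :
    HasSum (fun m : ℤ ↦ cexp (2 * Real.pi * I * τ * ((m : ℂ) + 1 / 2) ^ 2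
      + 4 * Real.pi * I * ((m : ℂ) + 1 / 2) * v)) (Th1 τ v) := by
  have h2 : 0 < (2 * τ).im := by simpa using hτ
  refine Summable.hasSum ((((summable_jacobiTheta₂_term_iff (2 * v + τ) (2 * τ)).2 h2).mul_left
    (cexp (Real.pi * I * τ / 2 + 2 * Real.pi * I * v))).congr fun m ↦ ?_)
  rw [jacobiTheta₂_term, ← Complex.exp_add]
  congr 1; ring

theorem HasSum.mul_complex {f g : ℤ → ℂ} {a b : ℂ} (hf : HasSum f a) (hg : HasSum g b) :
    HasSum (fun p : ℤ × ℤ ↦ f p.1 * g p.2) (a * b) :=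
  hf.mul hg (summable_mul_of_summable_norm (f := f) (g := g) hf.summable.norm hg.summable.norm)

/-- Weierstrass' addition formula for the second order theta functions. -/
theorem Th1_mul_Th0_sub {τ : ℂ} (hτ : 0 < τ.im) (v v' : ℂ) :
    Th1 τ v * Th0 τ v' - Th0 τ v * Th1 τ v' = cexp (Real.pi * I * (τ / 2 + 2 * v)) *
      (jacobiTheta₂ (v + v' + τ / 2 + 1 / 2) τ * jacobiTheta₂ (v - v' + τ / 2 + 1 / 2) τ) := by
  set F : ℤ × ℤ → ℂ := fun p ↦ cexp (Real.pi * I * (τ / 2 + 2 * v)) *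
    (jacobiTheta₂_term p.1 (v + v' + τ / 2 + 1 / 2) τ *
      jacobiTheta₂_term p.2 (v - v' + τ / 2 + 1 / 2) τ) with hF
  have hs (z : ℂ) := hasSum_jacobiTheta₂_term z hτ
  have hsum := ((hs (v + v' + τ / 2 + 1 / 2)).mul_complex (hs (v - v' + τ / 2 + 1 / 2))).mul_left
    (cexp (Real.pi * I * (τ / 2 + 2 * v)))
  let g : ℤ × ℤ → ℤ × ℤ := fun p ↦ (p.1 + p.2, p.1 - p.2)
  let g' : ℤ × ℤ → ℤ × ℤ := fun p ↦ (p.1 + p.2, p.1 - p.2 - 1)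
  have hg : g.Injective := by
    rintro ⟨a, b⟩ ⟨c, d⟩ h
    simp only [g, Prod.mk.injEq] at h ⊢; omega
  have hg' : g'.Injective := by
    rintro ⟨a, b⟩ ⟨c, d⟩ h
    simp only [g', Prod.mk.injEq] at h ⊢; omega
  have hcompl : IsCompl (Set.range g) (Set.range g') := by
    constructor
    · rw [Set.disjoint_left]
      rintro _ ⟨⟨a, b⟩, rfl⟩ ⟨⟨c, d⟩, h⟩
      simp only [g, g', Prod.mk.injEq] at h; omega
    · refine codisjoint_iff.2 (Set.eq_univ_of_forall ?_)
      rintro ⟨j, k⟩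
      rcases Int.even_or_odd' (j + k) with ⟨m, h | h⟩
      · exact .inl ⟨(m, j - m), by simp only [g, Prod.mk.injEq]; omega⟩
      · exact .inr ⟨(m + 1, j - m - 1), by simp only [g', Prod.mk.injEq]; omega⟩
  have hexp : ∀ (w w' : ℂ) (m : ℤ), w = w' + m * (2 * Real.pi * I) → cexp w = cexp w' :=
    fun w w' m h ↦ exp_eq_exp_iff_exists_int.2 ⟨m, h⟩
  have h1 : HasSum (F ∘ g) (Th1 τ v * Th0 τ v') := by
    have := (hasSum_Th1 hτ v).mul_complex (hasSum_Th0 hτ v')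
    refine this.congr_fun fun p ↦ ?_
    simp only [hF, g, Function.comp, jacobiTheta₂_term, ← Complex.exp_add]
    refine hexp _ _ p.1 ?_
    push_cast; ring
  have h2 : HasSum (F ∘ g') (-(Th0 τ v * Th1 τ v')) := by
    have := ((hasSum_Th0 hτ v).mul_complex (hasSum_Th1 hτ v')).neg
    refine this.congr_fun fun p ↦ ?_
    simp only [hF, g', Function.comp, jacobiTheta₂_term, ← Complex.exp_add]
    rw [← neg_one_mul, ← Complex.exp_pi_mul_I, ← Complex.exp_add]
    refine hexp _ _ (p.1 - 1) ?_
    push_cast; ring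
  rw [sub_eq_add_neg]
  exact (HasSum.add_isCompl (f := F) hcompl (hg.hasSum_range_iff.2 h1)
    (hg'.hasSum_range_iff.2 h2)).unique hsum

/-- `Θ₀(u+τ/4)Θ₁(u'+τ/4) = Θ₁(u+τ/4)Θ₀(u'+τ/4)` holds iff
`u' − u ∈ Λ_τ` or `u' + u − (1 + τ/2) ∈ Λ_τ`, i.e. the map `Φ₂ : ℂ/Λ_τ → ℙ¹`,
`u ↦ (Θ₀(u+τ/4) : −iΘ₁(u+τ/4))`, is a branched double cover whose fiber through `u`
is `{u, 1 + τ/2 − u}`. -/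
theorem theta_double_cover_two (τ : ℂ) (hτ : 0 < τ.im) (u u' : ℂ) :
    Th0 τ (u + τ / 4) * Th1 τ (u' + τ / 4)
        = Th1 τ (u + τ / 4) * Th0 τ (u' + τ / 4) ↔
      inLattice τ (u' - u) ∨ inLattice τ (u' + u - (1 + τ / 2)) := by
  rw [eq_comm, ← sub_eq_zero, Th1_mul_Th0_sub hτ, mul_eq_zero, or_iff_right (exp_ne_zero _),
    mul_eq_zero, jacobiTheta₂_eq_zero_iff hτ, jacobiTheta₂_eq_zero_iff hτ, or_comm]
  refine or_congr ⟨?_, ?_⟩ ⟨?_, ?_⟩ <;> rintro ⟨m, n, h⟩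
  · exact ⟨-m, -n, by push_cast; linear_combination -h⟩
  · exact ⟨-m, -n, by push_cast; linear_combination -h⟩
  · exact ⟨m - 1, n - 1, by push_cast; linear_combination h⟩
  · exact ⟨m + 1, n + 1, by push_cast; linear_combination h⟩
end
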